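/- Let A = KQ/I be a finite-dimensional algebra over an algebraically closed field K, where Q is a finite quiver with vertex set Q_0 = {1,…,n} and I is an admissible ideal of KQ. If A is geometrically irreducible, then for every subset E ⊆ Q_0 the quotient algebra A_E := A/(A e_E A), where e_E := ∑_{i ∈ E} e_i is the sum of the primitive idempotents corresponding to the vertices in E, is also geometrically irreducible. -/

import Mathlib

open scoped BigOperators

noncomputable section
/-! ## Quivers and paths -/

/-- A finite quiver: finite sets of vertices and arrows together with source and
target maps. -/
structure FinQuiver : Type 1 where
  V : Type
  A : Type
  [fintypeV : Fintype V]
  [fintypeA : Fintype A]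
  [decEqV : DecidableEq V]
  [decEqA : DecidableEq A]
  src : A → V
  tgt : A → V

attribute [instance] FinQuiver.fintypeV FinQuiver.fintypeA FinQuiver.decEqV FinQuiver.decEqA

/-- A path of positive length in a quiver: a list of composable arrows `[a₁, …, aₘ]`
satisfying `s (aᵢ) = t (aᵢ₊₁)`. -/
structure QPath (Q : FinQuiver) : Type where
  arrows : List Q.A
  ne : arrows ≠ []
  chain : arrows.Chain' fun a b => Q.src a = Q.tgt b

namespace QPath

variable {Q : FinQuiver}

/-- The length of a path. -/
def length (p : QPath Q) : ℕ := p.arrows.length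

/-- The target `t (a₁)` of a path `(a₁, …, aₘ)`. -/
def tgt (p : QPath Q) : Q.V := Q.tgt (p.arrows.head p.ne)

/-- The source `s (aₘ)` of a path `(a₁, …, aₘ)`. -/
def src (p : QPath Q) : Q.V := Q.src (p.arrows.getLast p.ne)

/-- A path is a cycle if its source equals its target. -/
def IsCycle (p : QPath Q) : Prop := p.src = p.tgt

/-- A cycle `(a₁, …, aₘ)` is primitive if the vertices `s (a₁), …, s (aₘ)` are pairwise
different. -/
def IsPrimitive (p : QPath Q) : Prop := (p.arrows.map Q.src).Nodup

end QPath

/-! ## The path algebra, relations, admissible ideals and representation varieties -/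

/-- The defining relations presenting the path algebra `KQ` as a quotient of the free
algebra on the vertices and arrows of `Q`: the vertices become a complete set of
orthogonal idempotents summing to `1`, and `e_{t(a)} * a = a = a * e_{s(a)}` for every
arrow `a`. -/
inductive PathRel (K : Type) [Field K] (Q : FinQuiver) :
    FreeAlgebra K (Q.V ⊕ Q.A) → FreeAlgebra K (Q.V ⊕ Q.A) → Prop
  | idem (i : Q.V) : PathRel K Q
      (FreeAlgebra.ι K (Sum.inl i) * FreeAlgebra.ι K (Sum.inl i)) (FreeAlgebra.ι K (Sum.inl i))
  | orth (i j : Q.V) (h : i ≠ j) : PathRel K Q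
      (FreeAlgebra.ι K (Sum.inl i) * FreeAlgebra.ι K (Sum.inl j)) 0
  | sum_one : PathRel K Q (∑ i : Q.V, FreeAlgebra.ι K (Sum.inl i)) 1
  | tgt_mul (a : Q.A) : PathRel K Q
      (FreeAlgebra.ι K (Sum.inl (Q.tgt a)) * FreeAlgebra.ι K (Sum.inr a))
      (FreeAlgebra.ι K (Sum.inr a))
  | mul_src (a : Q.A) : PathRel K Q
      (FreeAlgebra.ι K (Sum.inr a) * FreeAlgebra.ι K (Sum.inl (Q.src a)))
      (FreeAlgebra.ι K (Sum.inr a))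

/-- The path algebra `KQ`. -/
abbrev PathAlgebra (K : Type) [Field K] (Q : FinQuiver) : Type := RingQuot (PathRel K Q)

variable (K : Type) [Field K] (Q : FinQuiver)

/-- The idempotent `eᵢ ∈ KQ` corresponding to a vertex `i` (the path of length zero
at `i`). -/
def vertexElem (i : Q.V) : PathAlgebra K Q :=
  RingQuot.mkAlgHom K (PathRel K Q) (FreeAlgebra.ι K (Sum.inl i))

/-- The element of `KQ` corresponding to an arrow `a`. -/
def arrowElem (a : Q.A) : PathAlgebra K Q :=
  RingQuot.mkAlgHom K (PathRel K Q) (FreeAlgebra.ι K (Sum.inr a))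

/-- The element of `KQ` corresponding to a path `(a₁, …, aₘ)`, namely `a₁ ⋯ aₘ`. -/
def pathElem (p : QPath Q) : PathAlgebra K Q := (p.arrows.map (arrowElem K Q)).prod

/-- The element `∑ₚ c p • p` of `KQ` determined by a finitely supported family of
coefficients on paths. -/
def relElem (c : QPath Q →₀ K) : PathAlgebra K Q := c.sum fun p l => l • pathElem K Q p

/-- `c` is the datum of a relation with common target `i` and common source `j`: all
paths in its support have length at least two, target `i` and source `j`.  (The paths in
the support are pairwise different and have nonzero coefficients by definition of a
finitely supported function.) -/
def IsRelationData (c : QPath Q →₀ K) (i j : Q.V) : Prop :=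
  ∀ p ∈ c.support, 2 ≤ p.length ∧ p.tgt = i ∧ p.src = j

/-- An element of `KQ` is a relation if it is a `K`-linear combination `∑ λₚ • p` of
pairwise different paths of length at least two having a common source and a common
target, with all `λₚ ≠ 0`. -/
def IsRelation (x : PathAlgebra K Q) : Prop :=
  ∃ (c : QPath Q →₀ K) (i j : Q.V), IsRelationData K Q c i j ∧ x = relElem K Q c

/-- The two-sided ideal generated by a set `S`, as a set: the additive subgroup generated
by all elements `a * s * b` with `s ∈ S`. -/
def twoSidedSpan (R : Type) [Ring R] (S : Set R) : Set R :=
  (AddSubgroup.closure {x | ∃ a b : R, ∃ s ∈ S, x = a * s * b} : AddSubgroup R)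

/-- `φ : KQ →ₐ[K] A` presents `A` as `KQ/I` with `I = ker φ` an admissible ideal:
`φ` is surjective, its kernel is generated (as a two-sided ideal) by a set of relations,
and there is some `m ≥ 2` such that all paths of length at least `m` lie in the kernel. -/
def IsAdmissiblePresentation {A : Type} [Ring A] [Algebra K A]
    (φ : PathAlgebra K Q →ₐ[K] A) : Prop :=
  Function.Surjective φ ∧
  (∃ S : Set (PathAlgebra K Q), (∀ x ∈ S, IsRelation K Q x) ∧
    twoSidedSpan (PathAlgebra K Q) S = {x | φ x = 0}) ∧
  ∃ m : ℕ, 2 ≤ m ∧ ∀ p : QPath Q, m ≤ p.length → φ (pathElem K Q p) = 0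

/-- The index type for the rows/columns of the matrices in a `d`-dimensional
representation: the basis vectors of `⊕ᵢ K^{dᵢ}`. -/
abbrev RepIx (d : Q.V → ℕ) : Type := (i : Q.V) × Fin (d i)

/-- The ambient affine space of `d`-dimensional representations.  An arrow `a` gets a
matrix; membership in `RepSet` forces the matrix of `a` to be concentrated in the block
with rows indexed by the block `t(a)` and columns indexed by the block `s(a)`, i.e. to be
(the block extension of) a `d (t a) × d (s a)`-matrix. -/
abbrev RepSpace (d : Q.V → ℕ) : Type := Q.A → Matrix (RepIx Q d) (RepIx Q d) K

/-- The Zariski topology on affine space `K^ι`: generated by the complements of zero sets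
of polynomials in the coordinates. -/
def zariskiTopology (ι R : Type) [CommSemiring R] : TopologicalSpace (ι → R) :=
  TopologicalSpace.generateFrom
    {U | ∃ f : MvPolynomial ι R, U = {x | MvPolynomial.eval x f ≠ 0}}

/-- The Zariski topology on the ambient space of `d`-dimensional representations. -/
def repTopology (d : Q.V → ℕ) : TopologicalSpace (RepSpace K Q d) :=
  TopologicalSpace.induced (fun M (x : Q.A × RepIx Q d × RepIx Q d) => M x.1 x.2.1 x.2.2)
    (zariskiTopology (Q.A × RepIx Q d × RepIx Q d) K)

/-- The condition that the matrix of each arrow `a` is concentrated in the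
`(t a, s a)`-block, i.e. really is a `d (t a) × d (s a)`-matrix. -/
def BlockCompatible (d : Q.V → ℕ) (M : RepSpace K Q d) : Prop :=
  ∀ (a : Q.A) (u v : RepIx Q d), M a u v ≠ 0 → u.1 = Q.tgt a ∧ v.1 = Q.src a

/-- The evaluation `M(p) = M(a₁) ⋯ M(aₘ)` of a representation at a path. -/
def pathProd (d : Q.V → ℕ) (M : RepSpace K Q d) (p : QPath Q) :
    Matrix (RepIx Q d) (RepIx Q d) K := (p.arrows.map M).prod

/-- The evaluation `M(ρ) = ∑ λₚ M(p)` of a representation at a linear combination of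
paths. -/
def relEval (d : Q.V → ℕ) (M : RepSpace K Q d) (c : QPath Q →₀ K) :
    Matrix (RepIx Q d) (RepIx Q d) K := c.sum fun p l => l • pathProd K Q d M p

/-- The affine variety `rep(A, d)` of `d`-dimensional representations of `A = KQ/I`,
where `I = ker φ`: tuples of matrices (of the correct block sizes) with `M(ρ) = 0` for
every relation `ρ ∈ I`. -/
def RepSet {A : Type} [Ring A] [Algebra K A] (φ : PathAlgebra K Q →ₐ[K] A) (d : Q.V → ℕ) :
    Set (RepSpace K Q d) :=
  {M | BlockCompatible K Q d M ∧
    ∀ (c : QPath Q →₀ K) (i j : Q.V), IsRelationData K Q c i j →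
      φ (relElem K Q c) = 0 → relEval K Q d M c = 0}

/-- `A = KQ/I` (presented by `φ`, with `I = ker φ`) is geometrically irreducible if
`rep(A, d)` is an irreducible topological space for every dimension vector `d`. -/
def IsGeomIrreducible {A : Type} [Ring A] [Algebra K A] (φ : PathAlgebra K Q →ₐ[K] A) :
    Prop :=
  ∀ d : Q.V → ℕ, @IsIrreducible _ (repTopology K Q d) (RepSet K Q φ d)

section Presentations

variable {K Q}

/-- Two algebra homomorphisms out of a path algebra agree as soon as they agree on vertices
and arrows. -/
theorem pathAlgebra_hom_ext {C : Type} [Semiring C] [Algebra K C] {f g : PathAlgebra K Q →ₐ[K] C}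
    (hv : ∀ i, f (vertexElem K Q i) = g (vertexElem K Q i))
    (ha : ∀ a, f (arrowElem K Q a) = g (arrowElem K Q a)) : f = g := by
  apply RingQuot.ringQuot_ext'
  apply FreeAlgebra.hom_ext
  funext x
  rcases x with i | a
  · exact hv i
  · exact ha a

/-- The universal property of the path algebra. -/
theorem exists_pathAlgebra_hom {C : Type} [Semiring C] [Algebra K C] (p : Q.V → C) (m : Q.A → C)
    (hidem : ∀ i, p i * p i = p i) (horth : ∀ i j, i ≠ j → p i * p j = 0)
    (hsum : ∑ i, p i = 1) (ht : ∀ a, p (Q.tgt a) * m a = m a)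
    (hs : ∀ a, m a * p (Q.src a) = m a) :
    ∃ h : PathAlgebra K Q →ₐ[K] C,
      (∀ i, h (vertexElem K Q i) = p i) ∧ ∀ a, h (arrowElem K Q a) = m a := by
  have w : ∀ ⦃x y⦄, PathRel K Q x y → FreeAlgebra.lift K (Sum.elim p m) x =
      FreeAlgebra.lift K (Sum.elim p m) y := by
    intro x y hxy
    cases hxy with
    | idem i => simp [hidem]
    | orth i j h => simp [horth i j h]
    | sum_one => simp [hsum]
    | tgt_mul a => simp [ht]
    | mul_src a => simp [hs]
  refine ⟨RingQuot.liftAlgHom K ⟨FreeAlgebra.lift K (Sum.elim p m), w⟩, fun i => ?_, fun a => ?_⟩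
  · rw [vertexElem, RingQuot.liftAlgHom_mkAlgHom_apply]
    simp
  · rw [arrowElem, RingQuot.liftAlgHom_mkAlgHom_apply]
    simp

theorem vertexElem_mul_self (i : Q.V) :
    vertexElem K Q i * vertexElem K Q i = vertexElem K Q i := by
  simpa [vertexElem] using RingQuot.mkAlgHom_rel K (PathRel.idem (K := K) i)

theorem vertexElem_mul_of_ne {i j : Q.V} (h : i ≠ j) :
    vertexElem K Q i * vertexElem K Q j = 0 := by
  simpa [vertexElem] using RingQuot.mkAlgHom_rel K (PathRel.orth (K := K) i j h)

theorem sum_vertexElem : ∑ i, vertexElem K Q i = 1 := by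
  simpa [vertexElem] using RingQuot.mkAlgHom_rel K (PathRel.sum_one (K := K) (Q := Q))

theorem vertexElem_tgt_mul (a : Q.A) :
    vertexElem K Q (Q.tgt a) * arrowElem K Q a = arrowElem K Q a := by
  simpa [vertexElem, arrowElem] using RingQuot.mkAlgHom_rel K (PathRel.tgt_mul (K := K) a)

theorem arrowElem_mul_src (a : Q.A) :
    arrowElem K Q a * vertexElem K Q (Q.src a) = arrowElem K Q a := by
  simpa [vertexElem, arrowElem] using RingQuot.mkAlgHom_rel K (PathRel.mul_src (K := K) a)

theorem arrowElem_mul_of_ne {a b : Q.A} (h : Q.src a ≠ Q.tgt b) :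
    arrowElem K Q a * arrowElem K Q b = 0 := by
  rw [← arrowElem_mul_src a, ← vertexElem_tgt_mul b, mul_assoc, ← mul_assoc (vertexElem K Q _),
    vertexElem_mul_of_ne h]
  simp

theorem vertexElem_mul_arrowElem (i : Q.V) (a : Q.A) :
    vertexElem K Q i * arrowElem K Q a = if i = Q.tgt a then arrowElem K Q a else 0 := by
  split_ifs with h
  · rw [h, vertexElem_tgt_mul]
  · rw [← vertexElem_tgt_mul a, ← mul_assoc, vertexElem_mul_of_ne h, zero_mul]

theorem arrowElem_mul_vertexElem (i : Q.V) (a : Q.A) :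
    arrowElem K Q a * vertexElem K Q i = if i = Q.src a then arrowElem K Q a else 0 := by
  split_ifs with h
  · rw [h, arrowElem_mul_src]
  · rw [← arrowElem_mul_src a, mul_assoc, vertexElem_mul_of_ne (Ne.symm h), mul_zero]

theorem subset_twoSidedSpan {R : Type} [Ring R] (S : Set R) : S ⊆ twoSidedSpan R S :=
  fun s hs => AddSubgroup.subset_closure ⟨1, 1, s, hs, by simp⟩

theorem map_eq_zero_of_mem_twoSidedSpan {R C : Type} [Ring R] [Ring C] (f : R →+* C) {S : Set R}
    (hS : ∀ s ∈ S, f s = 0) {x : R} (hx : x ∈ twoSidedSpan R S) : f x = 0 := by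
  have hle : AddSubgroup.closure {x | ∃ a b : R, ∃ s ∈ S, x = a * s * b} ≤
      f.toAddMonoidHom.ker := by
    rw [AddSubgroup.closure_le]
    rintro _ ⟨a, b, s, hs, rfl⟩
    change f (a * s * b) = 0
    simp [hS s hs]
  exact hle hx

/-- An algebra homomorphism descends along a surjection whose kernel it kills. -/
theorem exists_algHom_factor {R B C : Type} [Ring R] [Algebra K R] [Ring B] [Algebra K B]
    [Ring C] [Algebra K C] (f : R →ₐ[K] B) (hf : Function.Surjective f) (g : R →ₐ[K] C)
    (hfg : ∀ x, f x = 0 → g x = 0) : ∃ h : B →ₐ[K] C, ∀ x, h (f x) = g x := by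
  have key : ∀ x y, f x = f y → g x = g y := fun x y hxy => by
    rw [← sub_eq_zero, ← map_sub]
    exact hfg _ (by rw [map_sub, hxy, sub_self])
  have hs := Function.surjInv_eq hf
  refine ⟨AlgHom.ofLinearMap
    { toFun := fun b => g (Function.surjInv hf b)
      map_add' := fun a b => ?_
      map_smul' := fun r b => ?_ } ?_ fun a b => ?_, fun x => key _ _ (hs _)⟩
  · rw [← map_add]
    exact key _ _ (by rw [map_add, hs, hs, hs])
  · rw [RingHom.id_apply, ← map_smul]
    exact key _ _ (by rw [map_smul, hs, hs])
  · exact (key _ 1 (by rw [hs, map_one])).trans (map_one g)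
  · change g _ = g _ * g _
    rw [← map_mul]
    exact key _ _ (by rw [map_mul, hs, hs, hs])

/-- The projection onto the summand at a vertex `i`. -/
def vertexProj (K : Type) [Field K] (Q : FinQuiver) (d : Q.V → ℕ) (i : Q.V) :
    Matrix (RepIx Q d) (RepIx Q d) K :=
  Matrix.diagonal fun u => if u.1 = i then 1 else 0

theorem vertexProj_mul_self (d : Q.V → ℕ) (i : Q.V) :
    vertexProj K Q d i * vertexProj K Q d i = vertexProj K Q d i := by
  simp [vertexProj]

theorem vertexProj_mul_of_ne (d : Q.V → ℕ) {i j : Q.V} (h : i ≠ j) :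
    vertexProj K Q d i * vertexProj K Q d j = 0 := by
  rw [vertexProj, vertexProj, Matrix.diagonal_mul_diagonal, ← Matrix.diagonal_zero]
  congr 1
  funext u
  by_cases hu : u.1 = i
  · simp [hu, h]
  · simp [hu]

theorem sum_vertexProj (d : Q.V → ℕ) : ∑ i, vertexProj K Q d i = 1 := by
  ext u v
  rw [Matrix.sum_apply]
  by_cases h : u = v
  · subst h
    simp [vertexProj]
  · simp [vertexProj, h]

theorem vertexProj_eq_zero (d : Q.V → ℕ) {i : Q.V} (h : d i = 0) : vertexProj K Q d i = 0 := by
  rw [vertexProj, ← Matrix.diagonal_zero]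
  congr 1
  funext u
  rw [if_neg]
  rintro rfl
  exact (Fin.cast h u.2).elim0

theorem blockCompatible_iff (d : Q.V → ℕ) (M : RepSpace K Q d) :
    BlockCompatible K Q d M ↔
      ∀ a, vertexProj K Q d (Q.tgt a) * M a = M a ∧ M a * vertexProj K Q d (Q.src a) = M a := by
  constructor
  · intro h a
    constructor
    · ext u v
      rw [vertexProj, Matrix.diagonal_mul]
      by_cases h0 : M a u v = 0
      · simp [h0]
      · simp [(h a u v h0).1]
    · ext u v
      rw [vertexProj, Matrix.mul_diagonal]
      by_cases h0 : M a u v = 0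
      · simp [h0]
      · simp [(h a u v h0).2]
  · intro h a u v h0
    constructor
    · by_contra hu
      apply h0
      rw [← (h a).1, vertexProj, Matrix.diagonal_mul]
      simp [hu]
    · by_contra hv
      apply h0
      rw [← (h a).2, vertexProj, Matrix.mul_diagonal]
      simp [hv]

theorem map_pathElem {C : Type} [Semiring C] [Algebra K C] (h : PathAlgebra K Q →ₐ[K] C)
    (p : QPath Q) :
    h (pathElem K Q p) = (p.arrows.map fun a => h (arrowElem K Q a)).prod := by
  rw [pathElem, map_list_prod, List.map_map]
  rfl

theorem map_relElem {d : Q.V → ℕ} {M : RepSpace K Q d}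
    (h : PathAlgebra K Q →ₐ[K] Matrix (RepIx Q d) (RepIx Q d) K)
    (hM : ∀ a, h (arrowElem K Q a) = M a) (c : QPath Q →₀ K) :
    h (relElem K Q c) = relEval K Q d M c := by
  rw [relElem, relEval, Finsupp.sum, Finsupp.sum, map_sum]
  refine Finset.sum_congr rfl fun p _ => ?_
  rw [map_smul, map_pathElem, pathProd]
  simp_rw [hM]

/-- Points of `rep(A, d)` are the same as algebra homomorphisms from `A` to the matrix algebra
sending the vertex idempotents to the standard projections. -/
theorem mem_repSet_iff {A : Type} [Ring A] [Algebra K A] {φ : PathAlgebra K Q →ₐ[K] A}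
    (hφ : IsAdmissiblePresentation K Q φ) (d : Q.V → ℕ) (M : RepSpace K Q d) :
    M ∈ RepSet K Q φ d ↔ ∃ h : A →ₐ[K] Matrix (RepIx Q d) (RepIx Q d) K,
      (∀ i, h (φ (vertexElem K Q i)) = vertexProj K Q d i) ∧
        ∀ a, h (φ (arrowElem K Q a)) = M a := by
  obtain ⟨hsurj, ⟨S, hS, hker⟩, -⟩ := hφ
  constructor
  · rintro ⟨hblock, hrel⟩
    rw [blockCompatible_iff] at hblock
    obtain ⟨ρ, hρv, hρa⟩ := exists_pathAlgebra_hom (K := K) (Q := Q) (vertexProj K Q d) M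
      (vertexProj_mul_self d) (fun i j => vertexProj_mul_of_ne d) (sum_vertexProj d)
      (fun a => (hblock a).1) (fun a => (hblock a).2)
    have hle : ∀ x, φ x = 0 → ρ x = 0 := by
      intro x hx
      have hx' : x ∈ twoSidedSpan (PathAlgebra K Q) S := by
        rw [hker]
        exact hx
      refine map_eq_zero_of_mem_twoSidedSpan ρ.toRingHom (fun s hs => ?_) hx'
      have hs0 : s ∈ {x | φ x = 0} := hker ▸ subset_twoSidedSpan S hs
      obtain ⟨c, i, j, hc, rfl⟩ := hS s hs
      exact (map_relElem ρ hρa c).trans (hrel c i j hc hs0)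
    obtain ⟨h, hh⟩ := exists_algHom_factor φ hsurj ρ hle
    exact ⟨h, fun i => by rw [hh, hρv], fun a => by rw [hh, hρa]⟩
  · rintro ⟨h, hv, ha⟩
    constructor
    · rw [blockCompatible_iff]
      intro a
      rw [← ha, ← hv, ← hv, ← map_mul, ← map_mul, ← map_mul, ← map_mul, vertexElem_tgt_mul,
        arrowElem_mul_src]
      exact ⟨rfl, rfl⟩
    · intro c i j _ hc0
      rw [← map_relElem (h.comp φ) ha c]
      change h (φ _) = 0
      rw [hc0, map_zero]

/-- The span of all products of at least `k` arrows. -/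
def longSpan (K : Type) [Field K] (Q : FinQuiver) (k : ℕ) : Submodule K (PathAlgebra K Q) :=
  Submodule.span K {x | ∃ l : List Q.A, k ≤ l.length ∧ x = (l.map (arrowElem K Q)).prod}

theorem mul_mem_longSpan {j k : ℕ} {x y : PathAlgebra K Q} (hx : x ∈ longSpan K Q j)
    (hy : y ∈ longSpan K Q k) : x * y ∈ longSpan K Q (j + k) := by
  have hmul : longSpan K Q j * longSpan K Q k ≤ longSpan K Q (j + k) := by
    rw [longSpan, longSpan, Submodule.span_mul_span]
    apply Submodule.span_mono
    rintro _ ⟨_, ⟨l, hl, rfl⟩, _, ⟨l', hl', rfl⟩, rfl⟩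
    exact ⟨l ++ l', by rw [List.length_append]; omega, by simp⟩
  exact hmul (Submodule.mul_mem_mul hx hy)

theorem pow_mem_longSpan {x : PathAlgebra K Q} (hx : x ∈ longSpan K Q 1) (n : ℕ) :
    x ^ n ∈ longSpan K Q n := by
  induction n with
  | zero => exact Submodule.subset_span ⟨[], by simp, by simp⟩
  | succ n ih =>
    rw [pow_succ]
    exact mul_mem_longSpan ih hx

theorem longSpan_anti {j k : ℕ} (h : j ≤ k) : longSpan K Q k ≤ longSpan K Q j :=
  Submodule.span_mono fun _ ⟨l, hl, hx⟩ => ⟨l, h.trans hl, hx⟩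

theorem arrowElem_mem_longSpan (a : Q.A) : arrowElem K Q a ∈ longSpan K Q 1 :=
  Submodule.subset_span ⟨[a], by simp, by simp⟩

theorem vertexElem_mul_mem_longSpan (i : Q.V) {x : PathAlgebra K Q} (hx : x ∈ longSpan K Q 1) :
    vertexElem K Q i * x ∈ longSpan K Q 1 := by
  induction hx using Submodule.span_induction with
  | mem x hx =>
    obtain ⟨l, hl, rfl⟩ := hx
    rcases l with _ | ⟨a, l⟩
    · simp at hl
    · rw [List.map_cons, List.prod_cons, ← mul_assoc, vertexElem_mul_arrowElem]
      split_ifs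
      · exact Submodule.subset_span ⟨a :: l, hl, by simp⟩
      · simp
  | zero => simp
  | add x y _ _ hx hy => rw [mul_add]; exact add_mem hx hy
  | smul r x _ hx => rw [mul_smul_comm]; exact Submodule.smul_mem _ _ hx

theorem mul_vertexElem_mem_longSpan (i : Q.V) {x : PathAlgebra K Q} (hx : x ∈ longSpan K Q 1) :
    x * vertexElem K Q i ∈ longSpan K Q 1 := by
  induction hx using Submodule.span_induction with
  | mem x hx =>
    obtain ⟨l, hl, rfl⟩ := hx
    rcases List.eq_nil_or_concat l with rfl | ⟨l, a, rfl⟩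
    · simp at hl
    · rw [List.concat_eq_append, List.map_append, List.prod_append, List.map_singleton,
        List.prod_singleton, mul_assoc, arrowElem_mul_vertexElem]
      split_ifs
      · exact Submodule.subset_span ⟨l ++ [a], by simp, by simp⟩
      · simp
  | zero => simp
  | add x y _ _ hx hy => rw [add_mul]; exact add_mem hx hy
  | smul r x _ hx => rw [smul_mul_assoc]; exact Submodule.smul_mem _ _ hx

theorem exists_sub_sum_vertexElem_mem (x : PathAlgebra K Q) :
    ∃ c : Q.V → K, x - ∑ i, c i • vertexElem K Q i ∈ longSpan K Q 1 := by
  obtain ⟨y, rfl⟩ := RingQuot.mkAlgHom_surjective K (PathRel K Q) x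
  induction y using FreeAlgebra.induction with
  | grade0 r =>
    refine ⟨fun _ => r, ?_⟩
    rw [← Finset.smul_sum, sum_vertexElem, AlgHom.commutes, Algebra.algebraMap_eq_smul_one,
      sub_self]
    exact zero_mem _
  | grade1 z =>
    rcases z with i | a
    · refine ⟨Pi.single i 1, ?_⟩
      have h : ∑ j, (Pi.single i 1 : Q.V → K) j • vertexElem K Q j = vertexElem K Q i := by
        rw [Finset.sum_eq_single i]
        · simp
        · intro j _ hj
          simp [hj]
        · simp
      rw [h, vertexElem, sub_self]
      exact zero_mem _
    · refine ⟨0, ?_⟩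
      simpa [arrowElem] using arrowElem_mem_longSpan (K := K) a
  | mul y z hy hz =>
    obtain ⟨c, hc⟩ := hy
    obtain ⟨c', hc'⟩ := hz
    refine ⟨fun i => c i * c' i, ?_⟩
    rw [map_mul]
    generalize RingQuot.mkAlgHom K (PathRel K Q) y = x at hc
    generalize RingQuot.mkAlgHom K (PathRel K Q) z = x' at hc'
    set v := ∑ i, c i • vertexElem K Q i with hv
    set v' := ∑ i, c' i • vertexElem K Q i with hv'
    have hvv : ∑ i, (c i * c' i) • vertexElem K Q i = v * v' := by
      rw [hv, hv', Finset.sum_mul_sum]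
      refine Finset.sum_congr rfl fun i _ => ?_
      rw [Finset.sum_eq_single i]
      · rw [smul_mul_smul_comm, vertexElem_mul_self]
      · intro j _ hj
        rw [smul_mul_smul_comm, vertexElem_mul_of_ne hj.symm, smul_zero]
      · simp
    have hsplit : x * x' - v * v' = v * (x' - v') + (x - v) * v' + (x - v) * (x' - v') := by
      simp only [mul_sub, sub_mul]
      abel
    rw [hvv, hsplit]
    refine add_mem (add_mem ?_ ?_) (longSpan_anti (by omega) (mul_mem_longSpan hc hc'))
    · rw [hv, Finset.sum_mul]
      refine sum_mem fun i _ => ?_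
      rw [smul_mul_assoc]
      exact Submodule.smul_mem _ _ (vertexElem_mul_mem_longSpan i hc')
    · rw [hv', Finset.mul_sum]
      refine sum_mem fun i _ => ?_
      rw [mul_smul_comm]
      exact Submodule.smul_mem _ _ (mul_vertexElem_mem_longSpan i hc)
  | add y z hy hz =>
    obtain ⟨c, hc⟩ := hy
    obtain ⟨c', hc'⟩ := hz
    refine ⟨c + c', ?_⟩
    have := add_mem hc hc'
    simp only [Pi.add_apply, add_smul, Finset.sum_add_distrib, map_add]
    rwa [add_sub_add_comm]

theorem prod_arrowElem_eq_zero (l : List Q.A)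
    (hl : ¬ l.IsChain fun a b => Q.src a = Q.tgt b) : (l.map (arrowElem K Q)).prod = 0 := by
  induction l with
  | nil => simp at hl
  | cons a l ih =>
    rcases l with _ | ⟨b, l⟩
    · simp at hl
    · rw [List.isChain_cons_cons, not_and_or] at hl
      rw [List.map_cons, List.prod_cons]
      rcases hl with h | h
      · rw [List.map_cons, List.prod_cons, ← mul_assoc, arrowElem_mul_of_ne h, zero_mul]
      · rw [ih h, mul_zero]

theorem exists_map_longSpan_eq_zero {A : Type} [Ring A] [Algebra K A]
    {φ : PathAlgebra K Q →ₐ[K] A} (hφ : IsAdmissiblePresentation K Q φ) :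
    ∃ m, ∀ x ∈ longSpan K Q m, φ x = 0 := by
  obtain ⟨-, -, m, hm, hzero⟩ := hφ
  refine ⟨m, fun x hx => ?_⟩
  have hle : longSpan K Q m ≤ LinearMap.ker φ.toLinearMap := by
    rw [longSpan, Submodule.span_le]
    rintro _ ⟨l, hl, rfl⟩
    change φ _ = 0
    by_cases hc : l.IsChain fun a b => Q.src a = Q.tgt b
    · exact hzero ⟨l, by rintro rfl; simp at hl; omega, hc⟩ hl
    · rw [prod_arrowElem_eq_zero l hc, map_zero]
  exact hle hx

theorem isNilpotent_map_of_mem_longSpan {A : Type} [Ring A] [Algebra K A]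
    {φ : PathAlgebra K Q →ₐ[K] A} (hφ : IsAdmissiblePresentation K Q φ) {x : PathAlgebra K Q}
    (hx : x ∈ longSpan K Q 1) : IsNilpotent (φ x) := by
  obtain ⟨m, hm⟩ := exists_map_longSpan_eq_zero hφ
  exact ⟨m, by rw [← map_pow]; exact hm _ (pow_mem_longSpan hx m)⟩

/-- The algebra presented by an admissible ideal has one character for each vertex, and the
intersection of the kernels of these characters consists of nilpotent elements. -/
theorem exists_characters {A : Type} [Ring A] [Algebra K A]
    {φ : PathAlgebra K Q →ₐ[K] A} (hφ : IsAdmissiblePresentation K Q φ) :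
    ∃ χ : Q.V → (A →ₐ[K] K),
      (∀ i j, χ i (φ (vertexElem K Q j)) = if j = i then 1 else 0) ∧
        ∀ b, (∀ i, χ i b = 0) → IsNilpotent b := by
  have hex : ∀ i, ∃ χ : A →ₐ[K] K, ∀ j, χ (φ (vertexElem K Q j)) = if j = i then 1 else 0 := by
    intro i
    obtain ⟨h, hv, ha⟩ := exists_pathAlgebra_hom (K := K) (Q := Q) (C := K)
      (fun j => if j = i then 1 else 0) (fun _ => 0) (by simp)
      (by rintro j k hjk; by_cases hj : j = i <;> simp [hj]; exact fun hk => hjk (hj.trans hk.symm))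
      (by simp) (by simp) (by simp)
    obtain ⟨hsurj, ⟨S, hS, hker⟩, -⟩ := hφ
    obtain ⟨χ, hχ⟩ := exists_algHom_factor φ hsurj h (by
      intro x hx
      have hx' : x ∈ twoSidedSpan (PathAlgebra K Q) S := by
        rw [hker]
        exact hx
      refine map_eq_zero_of_mem_twoSidedSpan h.toRingHom (fun s hs => ?_) hx'
      obtain ⟨c, j, k, -, rfl⟩ := hS s hs
      change h _ = 0
      rw [relElem, Finsupp.sum, map_sum]
      refine Finset.sum_eq_zero fun p _ => ?_
      rw [map_smul, map_pathElem]
      obtain ⟨a, l, hl⟩ := List.exists_cons_of_ne_nil p.ne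
      simp [hl, ha])
    exact ⟨χ, fun j => by rw [hχ, hv]⟩
  choose χ hχ using hex
  refine ⟨χ, hχ, fun b hb => ?_⟩
  obtain ⟨x, rfl⟩ := hφ.1 b
  obtain ⟨c, hc⟩ := exists_sub_sum_vertexElem_mem x
  have hc0 : ∀ i, c i = 0 := by
    intro i
    have h0 := ((isNilpotent_map_of_mem_longSpan hφ hc).map (χ i)).eq_zero
    simpa [hb, hχ] using h0
  simpa [hc0] using isNilpotent_map_of_mem_longSpan hφ hc

theorem exists_vertex_of_character (η : PathAlgebra K Q →ₐ[K] K) :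
    ∃ i, ∀ j, η (vertexElem K Q j) = if j = i then 1 else 0 := by
  have hsum : ∑ i, η (vertexElem K Q i) ≠ 0 := by
    rw [← map_sum, sum_vertexElem, map_one]
    exact one_ne_zero
  obtain ⟨i, -, hi⟩ := Finset.exists_ne_zero_of_sum_ne_zero hsum
  refine ⟨i, fun j => ?_⟩
  split_ifs with h
  · subst h
    have := congrArg η (vertexElem_mul_self (K := K) j)
    rw [map_mul] at this
    exact mul_left_cancel₀ hi (by rw [this, mul_one])
  · have := congrArg η (vertexElem_mul_of_ne (K := K) h)
    rw [map_mul, map_zero] at this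
    exact (mul_eq_zero.1 this).resolve_right hi

/-- Two presentations of an algebra `B`, one admissible and one in which the arrows are nilpotent,
have conjugate vertex idempotents, up to discarding vertices mapped to zero. -/
theorem exists_conj_vertexElem {Q' : FinQuiver} {B : Type} [Ring B] [Algebra K B]
    {ψ : PathAlgebra K Q' →ₐ[K] B} (hψ : IsAdmissiblePresentation K Q' ψ)
    (θ : PathAlgebra K Q →ₐ[K] B) (hθ : Function.Surjective θ)
    (hnil : ∀ a, IsNilpotent (θ (arrowElem K Q a))) :
    ∃ (u : Bˣ) (τ : Q'.V → Q.V), Function.Injective τ ∧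
      (∀ i, ψ (vertexElem K Q' i) * u = u * θ (vertexElem K Q (τ i))) ∧
      (∀ j, j ∉ Set.range τ → θ (vertexElem K Q j) = 0) ∧
      ∀ i, θ (vertexElem K Q (τ i)) ≠ 0 := by
  obtain ⟨χ, hχ, hχnil⟩ := exists_characters hψ
  choose τ hτ using fun i => exists_vertex_of_character ((χ i).comp θ)
  replace hτ : ∀ i j, χ i (θ (vertexElem K Q j)) = if j = τ i then 1 else 0 := hτ
  have hinj : Function.Injective τ := by
    intro i j hij
    have hcomp : (χ i).comp θ = (χ j).comp θ := by
      refine pathAlgebra_hom_ext (fun k => ?_) fun a => ?_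
      · change χ i (θ _) = χ j (θ _)
        rw [hτ, hτ, hij]
      · change χ i (θ _) = χ j (θ _)
        rw [((hnil a).map (χ i)).eq_zero, ((hnil a).map (χ j)).eq_zero]
    obtain ⟨x, hx⟩ := hθ (ψ (vertexElem K Q' i))
    have h1 : χ i (θ x) = χ j (θ x) := DFunLike.congr_fun hcomp x
    rw [hx, hχ, hχ, if_pos rfl] at h1
    by_contra hne
    rw [if_neg hne] at h1
    exact one_ne_zero h1
  set u : B := ∑ i, ψ (vertexElem K Q' i) * θ (vertexElem K Q (τ i)) with hu
  have hunit : IsUnit u := by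
    have hn : IsNilpotent (1 - u) := by
      refine hχnil _ fun k => ?_
      rw [map_sub, map_one, hu, map_sum, Finset.sum_eq_single k]
      · rw [map_mul, hχ, hτ]
        simp
      · intro i _ hi
        rw [map_mul, hχ, if_neg hi, zero_mul]
      · simp
    simpa using hn.isUnit_one_sub
  refine ⟨hunit.unit, τ, hinj, fun i => ?_, fun j hj => ?_, fun i h0 => ?_⟩
  · rw [IsUnit.unit_spec, hu, Finset.mul_sum, Finset.sum_mul, Finset.sum_eq_single i,
      Finset.sum_eq_single i]
    · rw [← mul_assoc, ← map_mul, vertexElem_mul_self, mul_assoc, ← map_mul, vertexElem_mul_self]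
    · intro j _ hj
      rw [mul_assoc, ← map_mul, vertexElem_mul_of_ne (hinj.ne hj), map_zero, mul_zero]
    · simp
    · intro j _ hj
      rw [← mul_assoc, ← map_mul, vertexElem_mul_of_ne hj.symm, map_zero, zero_mul]
    · simp
  · have hn : IsNilpotent (θ (vertexElem K Q j)) := by
      refine hχnil _ fun i => ?_
      rw [hτ, if_neg]
      rintro rfl
      exact hj ⟨i, rfl⟩
    have hidem : IsIdempotentElem (θ (vertexElem K Q j)) := by
      rw [IsIdempotentElem, ← map_mul, vertexElem_mul_self]
    obtain ⟨n, hn⟩ := hn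
    rw [← hidem.pow_succ_eq n, pow_succ, hn, zero_mul]
  · have := hτ i (τ i)
    rw [h0, map_zero, if_pos rfl] at this
    exact zero_ne_one this

/-- Conjugating a homomorphism of algebras by a unit. -/
theorem exists_conj_hom {R B : Type} [Ring R] [Algebra K R] [Ring B] [Algebra K B]
    (ψ : R →ₐ[K] B) (u : Bˣ) :
    ∃ ψ' : R →ₐ[K] B, ∀ x, ψ' x = ↑u⁻¹ * ψ x * u := by
  refine ⟨AlgHom.ofLinearMap
    { toFun := fun x => ↑u⁻¹ * ψ x * u
      map_add' := fun x y => by rw [map_add, mul_add, add_mul]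
      map_smul' := fun r x => by simp } ?_ fun x y => ?_, fun x => rfl⟩
  · simp
  · simp [mul_assoc]

theorem IsAdmissiblePresentation.of_ker_eq {A B : Type} [Ring A] [Algebra K A] [Ring B]
    [Algebra K B] {φ : PathAlgebra K Q →ₐ[K] A} (hφ : IsAdmissiblePresentation K Q φ)
    {ψ : PathAlgebra K Q →ₐ[K] B} (hψ : Function.Surjective ψ) (h : ∀ x, φ x = 0 ↔ ψ x = 0) :
    IsAdmissiblePresentation K Q ψ := by
  simpa only [IsAdmissiblePresentation, hφ.1, hψ, h] using hφ

theorem repSet_eq_of_ker_eq {A B : Type} [Ring A] [Algebra K A] [Ring B]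
    [Algebra K B] {φ : PathAlgebra K Q →ₐ[K] A}
    {ψ : PathAlgebra K Q →ₐ[K] B} (h : ∀ x, φ x = 0 ↔ ψ x = 0) (d : Q.V → ℕ) :
    RepSet K Q φ d = RepSet K Q ψ d := by
  simp only [RepSet, h]

/-- The matrix entries of the action of a fixed word in vertices and arrows are polynomial
functions of the representation. -/
theorem exists_polynomial_entry (d : Q.V → ℕ) (y : FreeAlgebra K (Q.V ⊕ Q.A)) :
    ∀ u v : RepIx Q d, ∃ f : MvPolynomial (Q.A × RepIx Q d × RepIx Q d) K,
      ∀ M : RepSpace K Q d, MvPolynomial.eval (fun x => M x.1 x.2.1 x.2.2) f =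
        FreeAlgebra.lift K (Sum.elim (vertexProj K Q d) M) y u v := by
  induction y using FreeAlgebra.induction with
  | grade0 r =>
    intro u v
    refine ⟨MvPolynomial.C (algebraMap K (Matrix (RepIx Q d) (RepIx Q d) K) r u v), fun M => ?_⟩
    rw [MvPolynomial.eval_C, AlgHom.commutes]
  | grade1 z =>
    intro u v
    rcases z with i | a
    · exact ⟨MvPolynomial.C (vertexProj K Q d i u v), fun M => by simp⟩
    · exact ⟨MvPolynomial.X (a, u, v), fun M => by simp⟩
  | mul y z hy hz =>
    intro u v
    choose f hf using hy
    choose g hg using hz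
    refine ⟨∑ w, f u w * g w v, fun M => ?_⟩
    rw [map_mul, Matrix.mul_apply, map_sum]
    exact Finset.sum_congr rfl fun w _ => by rw [map_mul, hf, hg]
  | add y z hy hz =>
    intro u v
    obtain ⟨f, hf⟩ := hy u v
    obtain ⟨g, hg⟩ := hz u v
    exact ⟨f + g, fun M => by rw [map_add, map_add, hf, hg, Matrix.add_apply]⟩

/-- Maps between representation spaces with polynomial coordinates are Zariski continuous. -/
theorem continuous_of_polynomial {Q' : FinQuiver} {d : Q.V → ℕ} {d' : Q'.V → ℕ}
    (F : RepSpace K Q d → RepSpace K Q' d')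
    (hF : ∀ x : Q'.A × RepIx Q' d' × RepIx Q' d',
      ∃ f : MvPolynomial (Q.A × RepIx Q d × RepIx Q d) K, ∀ M : RepSpace K Q d,
        MvPolynomial.eval (fun y => M y.1 y.2.1 y.2.2) f = F M x.1 x.2.1 x.2.2) :
    @Continuous _ _ (repTopology K Q d) (repTopology K Q' d') F := by
  choose f hf using hF
  let := repTopology K Q d
  let := zariskiTopology (Q'.A × RepIx Q' d' × RepIx Q' d') K
  refine continuous_induced_rng.2 (continuous_generateFrom_iff.2 ?_)
  rintro _ ⟨g, rfl⟩
  refine ⟨{x | MvPolynomial.eval x (MvPolynomial.bind₁ f g) ≠ 0},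
    TopologicalSpace.isOpen_generateFrom_of_mem ⟨_, rfl⟩, ?_⟩
  ext M
  have heval : MvPolynomial.eval (fun y => M y.1 y.2.1 y.2.2) (MvPolynomial.bind₁ f g) =
      MvPolynomial.eval (fun x => F M x.1 x.2.1 x.2.2) g := by
    induction g using MvPolynomial.induction_on with
    | C r => simp
    | add p q hp hq => rw [map_add, map_add, map_add, hp, hq]
    | mul_X p x hp => rw [map_mul, map_mul, map_mul, hp, MvPolynomial.bind₁_X_right,
        MvPolynomial.eval_X, hf]
  simp only [Set.mem_preimage, Set.mem_ofPred_eq, Function.comp_apply, heval]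

/-- A dimension vector can be extended by zero along an injection of vertices. -/
theorem exists_extend_dimension {Q' : FinQuiver} {τ : Q'.V → Q.V} (hτ : Function.Injective τ)
    (d' : Q'.V → ℕ) : ∃ (d : Q.V → ℕ) (e : RepIx Q' d' ≃ RepIx Q d),
      (∀ x, (e x).1 = τ x.1) ∧ ∀ j, j ∉ Set.range τ → d j = 0 := by
  have hd : ∀ i, Function.extend τ d' 0 (τ i) = d' i := fun i => hτ.extend_apply _ _ i
  have h0 : ∀ j, j ∉ Set.range τ → Function.extend τ d' 0 j = 0 :=
    fun j hj => Function.extend_apply' _ _ _ fun ⟨i, hi⟩ => hj ⟨i, hi⟩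
  refine ⟨Function.extend τ d' 0, Equiv.ofBijective
    (fun x => ⟨τ x.1, Fin.cast (hd x.1).symm x.2⟩) ⟨?_, ?_⟩, fun x => rfl, h0⟩
  · rintro ⟨i, k⟩ ⟨j, l⟩ h
    obtain ⟨h1, h2⟩ := Sigma.mk.inj h
    obtain rfl := hτ h1
    simpa using h2
  · rintro ⟨j, k⟩
    by_cases hj : j ∈ Set.range τ
    · obtain ⟨i, rfl⟩ := hj
      exact ⟨⟨i, Fin.cast (hd i) k⟩, rfl⟩
    · exact (Fin.cast (h0 j hj) k).elim0

theorem vertexProj_submatrix {Q' : FinQuiver} {τ : Q'.V → Q.V} (hτ : Function.Injective τ)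
    {d' : Q'.V → ℕ} {d : Q.V → ℕ} (e : RepIx Q' d' ≃ RepIx Q d) (he : ∀ x, (e x).1 = τ x.1)
    (i : Q'.V) : (vertexProj K Q d (τ i)).submatrix e e = vertexProj K Q' d' i := by
  rw [vertexProj, vertexProj, Matrix.submatrix_diagonal_equiv]
  congr 1
  funext x
  simp [he, hτ.eq_iff]

end Presentations

/-- Let `A = KQ/I` be a finite-dimensional algebra over an algebraically
closed field `K`, where `Q` is a finite quiver and `I` is an admissible ideal of `KQ`.
If `A` is geometrically irreducible, then for every subset `E` of the vertices the
quotient algebra `A_E := A/(A e_E A)`, where `e_E = ∑_{i ∈ E} eᵢ`, is also geometrically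
irreducible.  (The quotient `A_E` is here an arbitrary algebra `B` together with a
surjection `π : A → B` whose kernel is the two-sided ideal generated by the idempotents
`eᵢ`, `i ∈ E`; geometric irreducibility of `A_E` means geometric irreducibility of any
admissible presentation `KQ'/I' ≅ A_E` of it.) -/
theorem geomIrreducible_quotient_by_vertex_idempotents [IsAlgClosed K]
    (A : Type) [Ring A] [Algebra K A] [Module.Finite K A]
    (φ : PathAlgebra K Q →ₐ[K] A) (hadm : IsAdmissiblePresentation K Q φ)
    (hirr : IsGeomIrreducible K Q φ) (E : Finset Q.V) :
    ∀ (B : Type) [Ring B] [Algebra K B], ∀ π : A →ₐ[K] B, Function.Surjective π →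
      {x | π x = 0} = twoSidedSpan A ((fun i => φ (vertexElem K Q i)) '' ↑E) →
      ∀ (Q' : FinQuiver) (ψ : PathAlgebra K Q' →ₐ[K] B),
        IsAdmissiblePresentation K Q' ψ → IsGeomIrreducible K Q' ψ := by
  intro B _ _ π hπ hker Q' ψ₀ hψ₀ d'
  have hθ : Function.Surjective (π.comp φ) := hπ.comp hadm.1
  obtain ⟨u, τ, hτ, hconj, hzero, hne⟩ := exists_conj_vertexElem hψ₀ (π.comp φ) hθ fun a =>
    (isNilpotent_map_of_mem_longSpan hadm (arrowElem_mem_longSpan a)).map π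
  obtain ⟨ψ, hψ⟩ := exists_conj_hom ψ₀ u
  have hkerψ : ∀ x, ψ₀ x = 0 ↔ ψ x = 0 := by
    intro x
    rw [hψ, Units.mul_left_eq_zero, Units.mul_right_eq_zero]
  have hψsurj : Function.Surjective ψ := by
    intro b
    obtain ⟨x, hx⟩ := hψ₀.1 (u * b * ↑u⁻¹)
    exact ⟨x, by simp [hψ, hx, mul_assoc]⟩
  have hψadm := hψ₀.of_ker_eq hψsurj hkerψ
  have hψv : ∀ i, ψ (vertexElem K Q' i) = π (φ (vertexElem K Q (τ i))) := by
    intro i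
    rw [hψ, mul_assoc, hconj, Units.inv_mul_cancel_left]
    rfl
  have hE : ∀ i ∈ E, π (φ (vertexElem K Q i)) = 0 := by
    intro i hi
    have hmem : φ (vertexElem K Q i) ∈ {x | π x = 0} := by
      rw [hker]
      exact subset_twoSidedSpan _ ⟨i, hi, rfl⟩
    exact hmem
  obtain ⟨d, e, he, hd⟩ := exists_extend_dimension hτ d'
  have hvanish : ∀ h : A →ₐ[K] Matrix (RepIx Q d) (RepIx Q d) K,
      (∀ i, h (φ (vertexElem K Q i)) = vertexProj K Q d i) → ∀ x, π x = 0 → h x = 0 := by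
    intro h hv x hx
    have hx' : x ∈ twoSidedSpan A ((fun i => φ (vertexElem K Q i)) '' ↑E) := by
      rw [← hker]
      exact hx
    refine map_eq_zero_of_mem_twoSidedSpan h.toRingHom ?_ hx'
    rintro _ ⟨i, hi, rfl⟩
    change h (φ _) = 0
    rw [hv, vertexProj_eq_zero]
    apply hd
    rintro ⟨k, rfl⟩
    exact hne k (hE _ hi)
  choose x hx using fun a => hθ (ψ (arrowElem K Q' a))
  choose y hy using fun a => RingQuot.mkAlgHom_surjective K (PathRel K Q) (x a)
  let G : RepSpace K Q d → FreeAlgebra K (Q.V ⊕ Q.A) →ₐ[K] Matrix (RepIx Q d) (RepIx Q d) K :=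
    fun M => FreeAlgebra.lift K (Sum.elim (vertexProj K Q d) M)
  let F : RepSpace K Q d → RepSpace K Q' d' := fun M a => (G M (y a)).submatrix e e
  have hcont : @Continuous _ _ (repTopology K Q d) (repTopology K Q' d') F :=
    continuous_of_polynomial F fun z => exists_polynomial_entry d (y z.1) (e z.2.1) (e z.2.2)
  have hG : ∀ (M : RepSpace K Q d) (h : B →ₐ[K] Matrix (RepIx Q d) (RepIx Q d) K),
      (∀ i, h (π (φ (vertexElem K Q i))) = vertexProj K Q d i) →
      (∀ a, h (π (φ (arrowElem K Q a))) = M a) →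
      ∀ a, G M (y a) = h (ψ (arrowElem K Q' a)) := by
    intro M h hv ha a
    have hcomp : G M = ((h.comp π).comp φ).comp (RingQuot.mkAlgHom K (PathRel K Q)) := by
      apply FreeAlgebra.hom_ext
      funext z
      rcases z with i | b
      · simpa [G, vertexElem] using (hv i).symm
      · simpa [G, arrowElem] using (ha b).symm
    rw [hcomp, ← hx, ← hy]
    rfl
  have himage : RepSet K Q' ψ₀ d' = F '' RepSet K Q φ d := by
    rw [repSet_eq_of_ker_eq hkerψ]
    ext N
    rw [mem_repSet_iff hψadm]
    constructor
    · rintro ⟨h, hv, ha⟩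
      let r : Matrix (RepIx Q' d') (RepIx Q' d') K →ₐ[K] Matrix (RepIx Q d) (RepIx Q d) K :=
        (Matrix.reindexAlgEquiv K K e).toAlgHom
      have hr : ∀ X, (r X).submatrix e e = X := fun X => by
        ext u v
        simp [r]
      have hv' : ∀ i, r (h (π (φ (vertexElem K Q i)))) = vertexProj K Q d i := by
        intro i
        by_cases hi : i ∈ Set.range τ
        · obtain ⟨k, rfl⟩ := hi
          rw [← hψv, hv, ← vertexProj_submatrix hτ e he]
          ext u v
          simp [r]
        · have h0 : π (φ (vertexElem K Q i)) = 0 := hzero i hi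
          rw [h0, map_zero, map_zero, vertexProj_eq_zero _ (hd i hi)]
      refine ⟨fun a => r (h (π (φ (arrowElem K Q a)))), ?_, ?_⟩
      · exact (mem_repSet_iff hadm d _).2 ⟨(r.comp h).comp π, hv', fun a => rfl⟩
      · funext a
        change (G _ (y a)).submatrix e e = N a
        rw [hG (fun a => r (h (π (φ (arrowElem K Q a))))) (r.comp h) hv' (fun a => rfl), ← ha]
        exact hr _
    · rintro ⟨M, hM, rfl⟩
      obtain ⟨h, hv, ha⟩ := (mem_repSet_iff hadm d M).1 hM
      obtain ⟨h', hh'⟩ := exists_algHom_factor π hπ h (hvanish h hv)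
      refine ⟨(Matrix.reindexAlgEquiv K K e.symm).toAlgHom.comp h', fun i => ?_, fun a => ?_⟩
      · rw [← vertexProj_submatrix hτ e he, ← hv, ← hh', ← hψv]
        rfl
      · change _ = (G M (y a)).submatrix e e
        rw [hG M h' (fun i => by rw [hh', hv]) (fun a => by rw [hh', ha])]
        rfl
  rw [himage]
  let := repTopology K Q d
  let := repTopology K Q' d'
  exact (hirr d).image F hcont.continuousOn
end
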